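/- arXiv:2605.13126 — 2 statements merged into one kernel-verified Lean document; each statement's English description precedes it below -/
import Mathlib

section
/- Let Y and Z be random variables with finite range on a probability space (Ω, 𝓕, μ). Let q₁ be a nonnegative real-valued function on range(Z) × range(Y) such that for every value z of Z, Σ_y q₁(z, y) = 1 (a variational conditional probability mass function), and such that q₁(z, y) > 0 whenever P(Z = z, Y = y) > 0. Then I[Y : Z ; μ] ≥ E_μ[ log q₁(Z, Y) ] + H[Y ; μ]. -/
open MeasureTheory

/-- Shannon entropy `H[X ; μ]` of a random variable `X` with finite range,
`H[X] = ∑ s, -P(X = s) log P(X = s)`. -/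
noncomputable def finEntropy {Ω S : Type*} [MeasurableSpace Ω] [Fintype S]
    (μ : Measure Ω) (X : Ω → S) : ℝ :=
  ∑ s : S, Real.negMulLog ((μ (X ⁻¹' {s})).toReal)

/-- Mutual information `I[X : Y ; μ] = H[X] + H[Y] - H[(X, Y)]` for random variables
with finite range. -/
noncomputable def finMutualInfo {Ω S T : Type*} [MeasurableSpace Ω] [Fintype S] [Fintype T]
    (μ : Measure Ω) (X : Ω → S) (Y : Ω → T) : ℝ :=
  finEntropy μ X + finEntropy μ Y - finEntropy μ (fun ω => (X ω, Y ω))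

/-- Conditional mutual information
`I[X : Y | Z ; μ] = H[(X, Z)] + H[(Y, Z)] - H[(X, Y, Z)] - H[Z]` for random
variables with finite range. -/
noncomputable def finCondMutualInfo {Ω S T U : Type*} [MeasurableSpace Ω]
    [Fintype S] [Fintype T] [Fintype U]
    (μ : Measure Ω) (X : Ω → S) (Y : Ω → T) (Z : Ω → U) : ℝ :=
  finEntropy μ (fun ω => (X ω, Z ω)) + finEntropy μ (fun ω => (Y ω, Z ω))
    - finEntropy μ (fun ω => (X ω, Y ω, Z ω)) - finEntropy μ Z

/-- Gibbs' inequality for a finite family of total mass `∑ i, p i` against a probability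
vector `w`, stated with entropy-type sums. -/
theorem sum_mul_log_add_sum_negMulLog_le {ι : Type*} [Fintype ι] (p w : ι → ℝ)
    (hp : ∀ i, 0 ≤ p i) (hw : ∀ i, 0 ≤ w i) (hw_sum : ∑ i, w i = 1)
    (hpw : ∀ i, 0 < p i → 0 < w i) :
    ∑ i, p i * Real.log (w i) + ∑ i, Real.negMulLog (p i) ≤ Real.negMulLog (∑ i, p i) := by
  set P := ∑ i, p i with hP
  have hP_nonneg : 0 ≤ P := Finset.sum_nonneg fun i _ => hp i
  have key : ∀ i, p i * Real.log (w i) + Real.negMulLog (p i) + p i * Real.log P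
      ≤ w i * P - p i := by
    intro i
    rcases (hp i).eq_or_lt with h | h
    · simpa [← h] using mul_nonneg (hw i) hP_nonneg
    · have hwi := hpw i h
      have hP_pos : 0 < P :=
        h.trans_le (Finset.single_le_sum (fun j _ => hp j) (Finset.mem_univ i))
      have hlog := Real.log_le_sub_one_of_pos (div_pos (mul_pos hwi hP_pos) h)
      rw [Real.log_div (mul_pos hwi hP_pos).ne' h.ne', Real.log_mul hwi.ne' hP_pos.ne'] at hlog
      have hmul := mul_le_mul_of_nonneg_left hlog h.le
      rw [mul_sub_one, mul_div_cancel₀ _ h.ne'] at hmul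
      simp only [Real.negMulLog]
      linarith
  have hsum := Finset.sum_le_sum fun i (_ : i ∈ Finset.univ) => key i
  rw [Finset.sum_add_distrib, Finset.sum_add_distrib, Finset.sum_sub_distrib,
    ← Finset.sum_mul, ← Finset.sum_mul, hw_sum, ← hP] at hsum
  simp only [Real.negMulLog] at hsum ⊢
  linarith

/-- The law of a finite-range random variable is the marginal of its joint law with another. -/
theorem measureReal_preimage_singleton_eq_sum {Ω S T : Type*} [MeasurableSpace Ω]
    [Fintype S] [MeasurableSpace S] [MeasurableSingletonClass S]
    [MeasurableSpace T] [MeasurableSingletonClass T]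
    (μ : Measure Ω) [IsFiniteMeasure μ] {Y : Ω → S} {Z : Ω → T}
    (hY : Measurable Y) (hZ : Measurable Z) (z : T) :
    μ.real (Z ⁻¹' {z}) = ∑ y, μ.real ((fun ω => (Y ω, Z ω)) ⁻¹' {(y, z)}) := by
  rw [← measureReal_biUnion_finset]
  · congr 1
    ext ω
    simp
  · intro y _ y' _ hne
    refine Set.disjoint_left.2 fun ω h h' => hne ?_
    simp only [Set.mem_preimage, Set.mem_singleton_iff, Prod.mk.injEq] at h h'
    exact h.1.symm.trans h'.1
  · exact fun y _ => (hY.prodMk hZ) (measurableSet_singleton _)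

/-- The expectation of a function of a finite-range random variable as a finite sum. -/
theorem integral_comp_eq_sum_measureReal {Ω S : Type*} [MeasurableSpace Ω]
    [Fintype S] [MeasurableSpace S] [MeasurableSingletonClass S]
    (μ : Measure Ω) [IsFiniteMeasure μ] {X : Ω → S} (hX : Measurable X) (f : S → ℝ) :
    ∫ ω, f (X ω) ∂μ = ∑ s, μ.real (X ⁻¹' {s}) * f s := by
  rw [← integral_map hX.aemeasurable (measurable_of_finite f).aestronglyMeasurable,
    integral_fintype .of_finite]
  simp [map_measureReal_apply hX (measurableSet_singleton _)]

/-- Simplified form of the paper's Proposition 1: if `q₁` is a variational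
conditional probability mass function (for every `z`, `∑ y, q₁ (z, y) = 1`) that is
positive on the joint support of `(Z, Y)`, then
`I[Y : Z ; μ] ≥ E_μ[log q₁(Z, Y)] + H[Y ; μ]`. -/
theorem mlgib_proposition_one_simplified {Ω S T : Type*} [MeasurableSpace Ω]
    [Fintype S] [MeasurableSpace S] [MeasurableSingletonClass S]
    [Fintype T] [MeasurableSpace T] [MeasurableSingletonClass T]
    (μ : Measure Ω) [IsProbabilityMeasure μ]
    (Y : Ω → S) (Z : Ω → T) (hY : Measurable Y) (hZ : Measurable Z)
    (q₁ : T × S → ℝ)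
    (hq₁_nonneg : ∀ p, 0 ≤ q₁ p)
    (hq₁_sum : ∀ z : T, ∑ y : S, q₁ (z, y) = 1)
    (hq₁_pos : ∀ z y, 0 < μ {ω | Z ω = z ∧ Y ω = y} → 0 < q₁ (z, y)) :
    finMutualInfo μ Y Z ≥ (∫ ω, Real.log (q₁ (Z ω, Y ω)) ∂μ) + finEntropy μ Y := by
  set p : S → T → ℝ := fun y z => μ.real ((fun ω => (Y ω, Z ω)) ⁻¹' {(y, z)}) with hp
  have hint : ∫ ω, Real.log (q₁ (Z ω, Y ω)) ∂μ
      = ∑ z, ∑ y, p y z * Real.log (q₁ (z, y)) := by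
    rw [integral_comp_eq_sum_measureReal μ (hY.prodMk hZ)
      (fun s => Real.log (q₁ (s.2, s.1))), Fintype.sum_prod_type_right]
  have hjoint : finEntropy μ (fun ω => (Y ω, Z ω)) = ∑ z, ∑ y, Real.negMulLog (p y z) :=
    Fintype.sum_prod_type_right _
  have hmarg : finEntropy μ Z = ∑ z, Real.negMulLog (∑ y, p y z) :=
    Finset.sum_congr rfl fun z _ =>
      congrArg Real.negMulLog (measureReal_preimage_singleton_eq_sum μ hY hZ z)
  have hpos : ∀ z y, 0 < p y z → 0 < q₁ (z, y) := by
    intro z y h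
    refine hq₁_pos z y ?_
    have hset : {ω | Z ω = z ∧ Y ω = y} = (fun ω => (Y ω, Z ω)) ⁻¹' {(y, z)} := by
      ext ω
      simp [and_comm]
    rw [hset]
    exact (ENNReal.toReal_pos_iff.1 h).1
  have hgibbs := Finset.sum_le_sum fun z (_ : z ∈ Finset.univ) =>
    sum_mul_log_add_sum_negMulLog_le (fun y => p y z) (fun y => q₁ (z, y))
      (fun _ => measureReal_nonneg) (fun _ => hq₁_nonneg _) (hq₁_sum z) (hpos z)
  rw [Finset.sum_add_distrib, ← hint, ← hjoint, ← hmarg] at hgibbs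
  rw [finMutualInfo]
  linarith
end

section
/- Let L be a natural number and let A, Z_X^(0), …, Z_X^(L), Z_A^(0), …, Z_A^(L), Z_H^(0), …, Z_H^(L) be random variables with finite range on a probability space (Ω, 𝓕, μ), ordered as A, Z_X^(0), Z_A^(0), Z_H^(0), Z_X^(1), Z_A^(1), Z_H^(1), …, Z_X^(L), Z_A^(L), Z_H^(L), and satisfying the Markovian dependence conditions: for every l ∈ {0, …, L}, (i) I[Z_A^(l) : P_l | (A, Z_X^(l))] = 0, where P_l denotes the tuple of all variables preceding Z_A^(l) in the ordering; (ii) I[Z_H^(l) : Q_l | (Z_A^(l), Z_X^(l))] = 0, where Q_l denotes the tuple of all variables preceding Z_H^(l) in the ordering; and (iii) if l < L, I[Z_X^(l+1) : R_l | (Z_H^(l), Z_A^(l))] = 0, where R_l denotes the tuple of all variables preceding Z_X^(l+1) in the ordering. Set 𝒟_s = (A, Z_X^(0)). Let S_H be a nonempty subset of {0, 1, …, L} and S_A = {max(S_H), max(S_H)+1, …, L}. Then I[𝒟_s : Z_H^(L) ; μ] ≤ Σ_{l ∈ S_A} I[Z_A^(l) : (A, Z_X^(l)) ; μ] + Σ_{l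 ∈ S_H} I[Z_H^(l) : (Z_A^(l), Z_X^(l)) ; μ]. -/
open MeasureTheory

/-- The ordered sequence of the `3 * L + 4` random variables
`A, Z_X⁽⁰⁾, Z_A⁽⁰⁾, Z_H⁽⁰⁾, Z_X⁽¹⁾, Z_A⁽¹⁾, Z_H⁽¹⁾, …, Z_X⁽ᴸ⁾, Z_A⁽ᴸ⁾, Z_H⁽ᴸ⁾`. -/
def mlVars {Ω S : Type*} (L : ℕ) (A : Ω → S) (ZX ZA ZH : Fin (L + 1) → Ω → S)
    (i : Fin (3 * L + 4)) : Ω → S :=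
  if _ : i.val = 0 then A
  else if _ : (i.val - 1) % 3 = 0 then ZX ⟨(i.val - 1) / 3, by omega⟩
  else if _ : (i.val - 1) % 3 = 1 then ZA ⟨(i.val - 1) / 3, by omega⟩
  else ZH ⟨(i.val - 1) / 3, by omega⟩

/-- The tuple of the first `k` variables of the ordered sequence `mlVars`, viewed as
a single random variable with finite range `Fin k → S`. -/
def mlPrefix {Ω S : Type*} (L : ℕ) (A : Ω → S) (ZX ZA ZH : Fin (L + 1) → Ω → S)
    (k : ℕ) (hk : k ≤ 3 * L + 4) : Ω → (Fin k → S) :=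
  fun ω i => mlVars L A ZX ZA ZH (Fin.castLE hk i) ω

section Entropy

variable {Ω S T U V : Type*} [MeasurableSpace Ω] [Fintype S] [Fintype T] [Fintype U] [Fintype V]

theorem exists_eq_of_negMulLog_measure_ne_zero {Ω S : Type*} [MeasurableSpace Ω] (μ : Measure Ω)
    (X : Ω → S) (s : S) (hs : Real.negMulLog ((μ (X ⁻¹' {s})).toReal) ≠ 0) : ∃ ω, X ω = s := by
  by_contra! hne
  have : X ⁻¹' {s} = ∅ := by ext ω; simp [hne ω]
  simp [this] at hs

/-- Entropy depends only on the partition of `Ω` into fibres. -/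
theorem finEntropy_congr (μ : Measure Ω) {X : Ω → S} {Y : Ω → T}
    (h : ∀ ω ω', X ω = X ω' ↔ Y ω = Y ω') : finEntropy μ X = finEntropy μ Y := by
  choose g hg using exists_eq_of_negMulLog_measure_ne_zero μ X
  have fibre_eq : ∀ ω, X ⁻¹' {X ω} = Y ⁻¹' {Y ω} := by
    intro ω; ext ω'; simp [h]
  have fibre_eq' : ∀ s hs, Y ⁻¹' {Y (g s hs)} = X ⁻¹' {s} := by
    intro s hs; rw [← fibre_eq, hg]
  unfold finEntropy
  refine Finset.sum_bij_ne_zero (fun s _ hs => Y (g s hs)) (by simp) ?_ ?_ ?_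
  · intro s _ hs s' _ hs' he
    rw [← hg s hs, ← hg s' hs', h, he]
  · intro t _ ht
    obtain ⟨ω, rfl⟩ := exists_eq_of_negMulLog_measure_ne_zero μ Y t ht
    rw [← fibre_eq] at ht
    exact ⟨X ω, Finset.mem_univ _, ht, (h _ _).1 (hg _ ht)⟩
  · intro s _ hs
    rw [fibre_eq']

theorem mul_log_add_log_sub_le {a b c d : ℝ} (ha : 0 ≤ a) (hab : a ≤ b) (hac : a ≤ c)
    (hbd : b ≤ d) :
    a * (Real.log b + Real.log c - Real.log a - Real.log d) ≤ b * c / d - a := by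
  rcases ha.eq_or_lt with rfl | ha
  · simp only [zero_mul, sub_zero]
    exact div_nonneg (mul_nonneg hab hac) (hab.trans hbd)
  have hb := ha.trans_le hab
  have hc := ha.trans_le hac
  have hd := hb.trans_le hbd
  have hlog := Real.log_le_sub_one_of_pos (x := b * c / (a * d)) (by positivity)
  rw [Real.log_div (by positivity) (by positivity), Real.log_mul hb.ne' hc.ne',
    Real.log_mul ha.ne' hd.ne'] at hlog
  calc _ = a * (Real.log b + Real.log c - (Real.log a + Real.log d)) := by ring
    _ ≤ a * (b * c / (a * d) - 1) := by gcongr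
    _ = _ := by field_simp

/-- Strong subadditivity of entropy, for a nonnegative mass function. -/
theorem sum_negMulLog_submodular (p : S → T → U → ℝ) (hp : ∀ x y z, 0 ≤ p x y z) :
    (∑ x, ∑ y, ∑ z, Real.negMulLog (p x y z)) + ∑ z, Real.negMulLog (∑ x, ∑ y, p x y z) ≤
      (∑ x, ∑ z, Real.negMulLog (∑ y, p x y z)) + ∑ y, ∑ z, Real.negMulLog (∑ x, p x y z) := by
  set b : S → U → ℝ := fun x z => ∑ y, p x y z with hb
  set c : T → U → ℝ := fun y z => ∑ x, p x y z with hc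
  set d : U → ℝ := fun z => ∑ x, ∑ y, p x y z with hd
  have hb0 : ∀ x z, 0 ≤ b x z := fun x z => Finset.sum_nonneg fun y _ => hp x y z
  have hcd : ∀ z, ∑ y, c y z = d z := fun z => Finset.sum_comm
  have key : ∀ z, ∑ x, ∑ y, p x y z *
      (Real.log (b x z) + Real.log (c y z) - Real.log (p x y z) - Real.log (d z)) ≤ 0 := by
    intro z
    calc _ ≤ ∑ x, ∑ y, (b x z * c y z / d z - p x y z) := by
          refine Finset.sum_le_sum fun x _ => Finset.sum_le_sum fun y _ => ?_
          refine mul_log_add_log_sub_le (hp x y z) ?_ ?_ ?_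
          · exact Finset.single_le_sum (f := fun y => p x y z) (fun y _ => hp x y z)
              (Finset.mem_univ y)
          · exact Finset.single_le_sum (f := fun x => p x y z) (fun x _ => hp x y z)
              (Finset.mem_univ x)
          · exact Finset.single_le_sum (f := fun x => b x z) (fun x _ => hb0 x z)
              (Finset.mem_univ x)
      _ = d z * d z / d z - d z := by
          simp only [Finset.sum_sub_distrib, ← Finset.sum_div, ← Finset.mul_sum,
            ← Finset.sum_mul, hcd]
          rfl
      _ = 0 := by simp
  have expand : ∀ z, ∑ x, ∑ y, p x y z *
      (Real.log (b x z) + Real.log (c y z) - Real.log (p x y z) - Real.log (d z)) =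
      (∑ x, ∑ y, Real.negMulLog (p x y z)) + Real.negMulLog (d z) -
        (∑ x, Real.negMulLog (b x z)) - ∑ y, Real.negMulLog (c y z) := by
    intro z
    have e1 : ∑ x, ∑ y, p x y z * Real.log (b x z) = - ∑ x, Real.negMulLog (b x z) := by
      simp [Real.negMulLog, ← Finset.sum_mul, hb]
    have e2 : ∑ x, ∑ y, p x y z * Real.log (c y z) = - ∑ y, Real.negMulLog (c y z) := by
      rw [Finset.sum_comm]; simp [Real.negMulLog, ← Finset.sum_mul, hc]
    have e3 : ∑ x, ∑ y, p x y z * Real.log (p x y z) =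
        - ∑ x, ∑ y, Real.negMulLog (p x y z) := by simp [Real.negMulLog]
    have e4 : ∑ x, ∑ y, p x y z * Real.log (d z) = - Real.negMulLog (d z) := by
      simp [Real.negMulLog, ← Finset.sum_mul, hd]
    simp only [mul_sub, mul_add, Finset.sum_sub_distrib, Finset.sum_add_distrib, e1, e2, e3, e4]
    ring
  have total := Finset.sum_nonpos fun z (_ : z ∈ Finset.univ) => key z
  simp only [expand, Finset.sum_sub_distrib, Finset.sum_add_distrib] at total
  have c1 : ∑ x, ∑ y, ∑ z, Real.negMulLog (p x y z) =
      ∑ z, ∑ x, ∑ y, Real.negMulLog (p x y z) := by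
    calc _ = ∑ x, ∑ z, ∑ y, Real.negMulLog (p x y z) :=
          Finset.sum_congr rfl fun x _ => Finset.sum_comm
      _ = _ := Finset.sum_comm
  have c2 : ∑ x, ∑ z, Real.negMulLog (b x z) = ∑ z, ∑ x, Real.negMulLog (b x z) :=
    Finset.sum_comm
  have c3 : ∑ y, ∑ z, Real.negMulLog (c y z) = ∑ z, ∑ y, Real.negMulLog (c y z) :=
    Finset.sum_comm
  rw [c1, c2, c3]
  linarith

theorem finMutualInfo_comm (μ : Measure Ω) (X : Ω → S) (Y : Ω → T) :
    finMutualInfo μ X Y = finMutualInfo μ Y X := by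
  have e : finEntropy μ (fun ω => (X ω, Y ω)) = finEntropy μ (fun ω => (Y ω, X ω)) :=
    finEntropy_congr μ (by simp [and_comm])
  simp only [finMutualInfo, e]
  ring

/-- If `X` and `Y` are conditionally independent given `Z`, adjoining `X` to `Z` reveals nothing
more about `Y`. -/
theorem finMutualInfo_prod_eq_of_condMutualInfo_eq_zero
    (μ : Measure Ω) {X : Ω → S} {Y : Ω → T} {Z : Ω → U}
    (h0 : finCondMutualInfo μ X Y Z = 0) :
    finMutualInfo μ Y (fun ω => (X ω, Z ω)) = finMutualInfo μ Y Z := by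
  have e : finEntropy μ (fun ω => (Y ω, X ω, Z ω)) = finEntropy μ (fun ω => (X ω, Y ω, Z ω)) :=
    finEntropy_congr μ fun ω ω' => by simp; tauto
  simp only [finCondMutualInfo] at h0
  simp only [finMutualInfo, e]
  linarith

variable [MeasurableSpace S] [MeasurableSingletonClass S] [MeasurableSpace T]
  [MeasurableSingletonClass T]

theorem measureReal_eq_sum_fibre (μ : Measure Ω) [IsFiniteMeasure μ] {Y : Ω → T}
    (hY : Measurable Y) (E : Set Ω) :
    (μ E).toReal = ∑ y, (μ (E ∩ Y ⁻¹' {y})).toReal := by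
  rw [← ENNReal.toReal_sum (fun _ _ => measure_ne_top _ _)]
  have := sum_measure_preimage_singleton (μ := μ.restrict E) (f := Y) Finset.univ
    (fun y _ => hY (measurableSet_singleton y))
  simp only [Finset.coe_univ, Set.preimage_univ, Measure.restrict_apply_univ] at this
  rw [← this]
  simp_rw [Measure.restrict_apply (hY (measurableSet_singleton _)), Set.inter_comm]

variable (μ : Measure Ω) [IsFiniteMeasure μ] {X : Ω → S} {Y : Ω → T} {Z : Ω → U}

/-- Strong subadditivity of entropy. -/
theorem finCondMutualInfo_nonneg (hX : Measurable X) (hY : Measurable Y) :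
    0 ≤ finCondMutualInfo μ X Y Z := by
  have h := sum_negMulLog_submodular
    (fun x y z => (μ ((fun ω => (X ω, Y ω, Z ω)) ⁻¹' {(x, y, z)})).toReal)
    (fun _ _ _ => ENNReal.toReal_nonneg)
  have hxz : ∀ x z, ∑ y, (μ ((fun ω => (X ω, Y ω, Z ω)) ⁻¹' {(x, y, z)})).toReal =
      (μ ((fun ω => (X ω, Z ω)) ⁻¹' {(x, z)})).toReal := by
    intro x z
    rw [measureReal_eq_sum_fibre μ hY]
    refine Finset.sum_congr rfl fun y _ => ?_
    congr 2; ext ω; simp; tauto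
  have hyz : ∀ y z, ∑ x, (μ ((fun ω => (X ω, Y ω, Z ω)) ⁻¹' {(x, y, z)})).toReal =
      (μ ((fun ω => (Y ω, Z ω)) ⁻¹' {(y, z)})).toReal := by
    intro y z
    rw [measureReal_eq_sum_fibre μ hX]
    refine Finset.sum_congr rfl fun x _ => ?_
    congr 2; ext ω; simp; tauto
  have hz : ∀ z, ∑ x, (μ ((fun ω => (X ω, Z ω)) ⁻¹' {(x, z)})).toReal =
      (μ (Z ⁻¹' {z})).toReal := by
    intro z
    rw [measureReal_eq_sum_fibre μ hX]
    refine Finset.sum_congr rfl fun x _ => ?_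
    congr 2; ext ω; simp; tauto
  simp only [hxz, hyz, hz] at h
  simp only [finCondMutualInfo, finEntropy, Fintype.sum_prod_type]
  linarith

/-- Entropy is subadditive. -/
theorem finMutualInfo_nonneg [IsProbabilityMeasure μ] (hX : Measurable X) (hY : Measurable Y) :
    0 ≤ finMutualInfo μ X Y := by
  have h := finCondMutualInfo_nonneg μ (Z := fun _ => ()) hX hY
  have e0 : finEntropy μ (fun _ : Ω => ()) = 0 := by simp [finEntropy]
  have e1 : finEntropy μ (fun ω => (X ω, ())) = finEntropy μ X :=
    finEntropy_congr μ (by simp)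
  have e2 : finEntropy μ (fun ω => (Y ω, ())) = finEntropy μ Y :=
    finEntropy_congr μ (by simp)
  have e3 : finEntropy μ (fun ω => (X ω, Y ω, ())) = finEntropy μ (fun ω => (X ω, Y ω)) :=
    finEntropy_congr μ (by simp)
  simp only [finCondMutualInfo, e0, e1, e2, e3] at h
  simp only [finMutualInfo]
  linarith

theorem finMutualInfo_comp_right_le (hX : Measurable X) (hY : Measurable Y) (f : T → U) :
    finMutualInfo μ X (fun ω => f (Y ω)) ≤ finMutualInfo μ X Y := by
  have h := finCondMutualInfo_nonneg μ (Z := fun ω => f (Y ω)) hX hY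
  have e1 : finEntropy μ (fun ω => (Y ω, f (Y ω))) = finEntropy μ Y :=
    finEntropy_congr μ fun ω ω' => by simp +contextual
  have e2 : finEntropy μ (fun ω => (X ω, Y ω, f (Y ω))) = finEntropy μ (fun ω => (X ω, Y ω)) :=
    finEntropy_congr μ fun ω ω' => by simp +contextual
  simp only [finCondMutualInfo, e1, e2] at h
  simp only [finMutualInfo]
  linarith

theorem finCondMutualInfo_comp_eq_zero [MeasurableSpace V] [MeasurableSingletonClass V]
    (hX : Measurable X) (hY : Measurable Y)
    (h0 : finCondMutualInfo μ X Y Z = 0) (f : T → V) :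
    finCondMutualInfo μ X (fun ω => f (Y ω)) Z = 0 := by
  have hfY : Measurable fun ω => f (Y ω) := (measurable_of_finite f).comp hY
  refine le_antisymm ?_ (finCondMutualInfo_nonneg μ hX hfY)
  have h := finCondMutualInfo_nonneg μ (Z := fun ω => (f (Y ω), Z ω)) hX hY
  have e1 : finEntropy μ (fun ω => (Y ω, f (Y ω), Z ω)) = finEntropy μ (fun ω => (Y ω, Z ω)) :=
    finEntropy_congr μ fun ω ω' => by simp +contextual
  have e2 : finEntropy μ (fun ω => (X ω, Y ω, f (Y ω), Z ω)) =
      finEntropy μ (fun ω => (X ω, Y ω, Z ω)) :=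
    finEntropy_congr μ fun ω ω' => by simp +contextual
  simp only [finCondMutualInfo, e1, e2] at h h0 ⊢
  linarith

/-- Data processing inequality. -/
theorem finMutualInfo_le_of_condMutualInfo_eq_zero [MeasurableSpace U]
    [MeasurableSingletonClass U]
    (hX : Measurable X) (hY : Measurable Y) (hZ : Measurable Z)
    (h0 : finCondMutualInfo μ X Y Z = 0) :
    finMutualInfo μ Y X ≤ finMutualInfo μ Y Z := by
  rw [← finMutualInfo_prod_eq_of_condMutualInfo_eq_zero μ h0]
  exact finMutualInfo_comp_right_le μ hY (hX.prodMk hZ) Prod.fst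

theorem finMutualInfo_le_of_condMutualInfo_eq_zero' [MeasurableSpace U]
    [MeasurableSingletonClass U]
    (hX : Measurable X) (hY : Measurable Y) (hZ : Measurable Z)
    (h0 : finCondMutualInfo μ X Y Z = 0) :
    finMutualInfo μ X Y ≤ finMutualInfo μ X Z := by
  have h := finMutualInfo_comp_right_le μ hX (hY.prodMk hZ) Prod.fst
  simp only [finCondMutualInfo] at h0
  simp only [finMutualInfo] at h ⊢
  linarith

theorem finMutualInfo_prod_le [MeasurableSpace U] [MeasurableSingletonClass U]
    [IsProbabilityMeasure μ] {D : Ω → V}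
    (hX : Measurable X) (hZ : Measurable Z) :
    finMutualInfo μ D (fun ω => (X ω, Z ω)) ≤
      finMutualInfo μ D Z + finMutualInfo μ X (fun ω => (D ω, Z ω)) := by
  have h := finMutualInfo_nonneg μ hX hZ
  have e : finEntropy μ (fun ω => (D ω, X ω, Z ω)) = finEntropy μ (fun ω => (X ω, D ω, Z ω)) :=
    finEntropy_congr μ fun ω ω' => by simp; tauto
  simp only [finMutualInfo, e] at h ⊢
  linarith

end Entropy

section Variables

variable {Ω S : Type*} (L : ℕ) (A : Ω → S) (ZX ZA ZH : Fin (L + 1) → Ω → S)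

theorem mlVars_zero (h : 0 < 3 * L + 4) : mlVars L A ZX ZA ZH ⟨0, h⟩ = A := by
  simp [mlVars]

theorem mlVars_ZX (l : Fin (L + 1)) (h : 3 * l.val + 1 < 3 * L + 4) :
    mlVars L A ZX ZA ZH ⟨3 * l.val + 1, h⟩ = ZX l := by
  simp [mlVars]

theorem mlVars_ZA (l : Fin (L + 1)) (h : 3 * l.val + 2 < 3 * L + 4) :
    mlVars L A ZX ZA ZH ⟨3 * l.val + 2, h⟩ = ZA l := by
  have h1 : (3 * l.val + 1) % 3 = 1 := by omega
  have h2 : (3 * l.val + 1) / 3 = l.val := by omega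
  simp [mlVars, h1, h2]

theorem measurable_mlPrefix [MeasurableSpace Ω] [MeasurableSpace S] (hA : Measurable A)
    (hZX : ∀ l, Measurable (ZX l)) (hZA : ∀ l, Measurable (ZA l)) (hZH : ∀ l, Measurable (ZH l))
    (k : ℕ) (hk : k ≤ 3 * L + 4) : Measurable (mlPrefix L A ZX ZA ZH k hk) := by
  refine measurable_pi_lambda _ fun i => ?_
  change Measurable (mlVars L A ZX ZA ZH (Fin.castLE hk i))
  unfold mlVars
  split_ifs
  exacts [hA, hZX _, hZA _, hZH _]

end Variables

/-- Proposition 2 of the paper, mutual-information form: under the Markovian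
dependence space 𝓜 — for each layer `l`, `Z_A⁽ˡ⁾` depends on the preceding
variables only through `(A, Z_X⁽ˡ⁾)`, `Z_H⁽ˡ⁾` only through `(Z_A⁽ˡ⁾, Z_X⁽ˡ⁾)`, and
`Z_X⁽ˡ⁺¹⁾` only through `(Z_H⁽ˡ⁾, Z_A⁽ˡ⁾)` — the information the final message
`Z_H⁽ᴸ⁾` carries about `𝒟_s = (A, Z_X⁽⁰⁾)` satisfies, for any nonempty
`S_H ⊆ {0, …, L}` and `S_A = {max S_H, …, L}`,
`I[𝒟_s : Z_H⁽ᴸ⁾] ≤ ∑_{l ∈ S_A} I[Z_A⁽ˡ⁾ : (A, Z_X⁽ˡ⁾)] + ∑_{l ∈ S_H} I[Z_H⁽ˡ⁾ : (Z_A⁽ˡ⁾, Z_X⁽ˡ⁾)]`. -/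
theorem mlgib_proposition_two {Ω S : Type*} [MeasurableSpace Ω]
    [Fintype S] [MeasurableSpace S] [MeasurableSingletonClass S]
    (μ : Measure Ω) [IsProbabilityMeasure μ]
    (L : ℕ) (A : Ω → S) (ZX ZA ZH : Fin (L + 1) → Ω → S)
    (hA : Measurable A) (hZX : ∀ l, Measurable (ZX l))
    (hZA : ∀ l, Measurable (ZA l)) (hZH : ∀ l, Measurable (ZH l))
    (hMarkovA : ∀ l : Fin (L + 1),
      finCondMutualInfo μ (ZA l)
        (mlPrefix L A ZX ZA ZH (2 + 3 * l.val) (by omega))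
        (fun ω => (A ω, ZX l ω)) = 0)
    (hMarkovH : ∀ l : Fin (L + 1),
      finCondMutualInfo μ (ZH l)
        (mlPrefix L A ZX ZA ZH (3 + 3 * l.val) (by omega))
        (fun ω => (ZA l ω, ZX l ω)) = 0)
    (hMarkovX : ∀ l : Fin (L + 1), ∀ h : l.val < L,
      finCondMutualInfo μ (ZX ⟨l.val + 1, by omega⟩)
        (mlPrefix L A ZX ZA ZH (4 + 3 * l.val) (by omega))
        (fun ω => (ZH l ω, ZA l ω)) = 0)
    (SH : Finset (Fin (L + 1))) (hSH : SH.Nonempty)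
    (SA : Finset (Fin (L + 1)))
    (hSA : SA = Finset.univ.filter (fun l : Fin (L + 1) => SH.max' hSH ≤ l)) :
    finMutualInfo μ (fun ω => (A ω, ZX 0 ω)) (ZH (Fin.last L)) ≤
      (∑ l ∈ SA, finMutualInfo μ (ZA l) (fun ω => (A ω, ZX l ω)))
        + ∑ l ∈ SH, finMutualInfo μ (ZH l) (fun ω => (ZA l ω, ZX l ω)) := by
  have hP := measurable_mlPrefix L A ZX ZA ZH hA hZX hZA hZH
  set D : Ω → S × S := fun ω => (A ω, ZX 0 ω) with hD
  have hDm : Measurable D := hA.prodMk (hZX 0)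
  have eA : ∀ h, mlVars L A ZX ZA ZH ⟨0, h⟩ = A := mlVars_zero L A ZX ZA ZH
  have eX0 : ∀ h, mlVars L A ZX ZA ZH ⟨1, h⟩ = ZX 0 := mlVars_ZX L A ZX ZA ZH 0
  have hAD : ∀ l, finCondMutualInfo μ (ZA l) D (fun ω => (A ω, ZX l ω)) = 0 := fun l => by
    have := finCondMutualInfo_comp_eq_zero μ (hZA l) (hP _ _) (hMarkovA l)
      (fun v => (v ⟨0, by omega⟩, v ⟨1, by omega⟩))
    simpa only [mlPrefix, Fin.castLE_mk, eA, eX0] using this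
  have hADX : ∀ l, finCondMutualInfo μ (ZA l) (fun ω => (D ω, ZX l ω))
      (fun ω => (A ω, ZX l ω)) = 0 := fun l => by
    have := finCondMutualInfo_comp_eq_zero μ (hZA l) (hP _ _) (hMarkovA l)
      (fun v => ((v ⟨0, by omega⟩, v ⟨1, by omega⟩), v ⟨3 * l.val + 1, by omega⟩))
    simpa only [mlPrefix, Fin.castLE_mk, eA, eX0, mlVars_ZX] using this
  have hHD : ∀ l, finCondMutualInfo μ (ZH l) D (fun ω => (ZA l ω, ZX l ω)) = 0 := fun l => by
    have := finCondMutualInfo_comp_eq_zero μ (hZH l) (hP _ _) (hMarkovH l)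
      (fun v => (v ⟨0, by omega⟩, v ⟨1, by omega⟩))
    simpa only [mlPrefix, Fin.castLE_mk, eA, eX0] using this
  have hHDA : ∀ l, finCondMutualInfo μ (ZH l) (fun ω => (D ω, ZA l ω))
      (fun ω => (ZA l ω, ZX l ω)) = 0 := fun l => by
    have := finCondMutualInfo_comp_eq_zero μ (hZH l) (hP _ _) (hMarkovH l)
      (fun v => ((v ⟨0, by omega⟩, v ⟨1, by omega⟩), v ⟨3 * l.val + 2, by omega⟩))
    simpa only [mlPrefix, Fin.castLE_mk, eA, eX0, mlVars_ZA] using this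
  have hXD : ∀ l : Fin (L + 1), ∀ h : l.val < L,
      finCondMutualInfo μ (ZX ⟨l.val + 1, by omega⟩) D (fun ω => (ZH l ω, ZA l ω)) = 0 :=
    fun l h => by
      have := finCondMutualInfo_comp_eq_zero μ (hZX _) (hP _ _) (hMarkovX l h)
        (fun v => (v ⟨0, by omega⟩, v ⟨1, by omega⟩))
      simpa only [mlPrefix, Fin.castLE_mk, eA, eX0] using this
  set m := SH.max' hSH with hm
  set a : Fin (L + 1) → ℝ := fun l => finMutualInfo μ (ZA l) (fun ω => (A ω, ZX l ω)) with ha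
  set b : Fin (L + 1) → ℝ := fun l => finMutualInfo μ (ZH l) (fun ω => (ZA l ω, ZX l ω)) with hb
  have layer : ∀ n, ∀ hn : n < L + 1, m.val ≤ n →
      finMutualInfo μ D (fun ω => (ZH ⟨n, hn⟩ ω, ZA ⟨n, hn⟩ ω)) ≤
        b m + ∑ l ∈ Finset.Icc m ⟨n, hn⟩, a l := by
    intro n hn hmn
    induction n, hmn using Nat.le_induction with
    | base =>
      have h1 := finMutualInfo_prod_le μ (D := D) (hZH m) (hZA m)
      have h2 := finMutualInfo_le_of_condMutualInfo_eq_zero' μ (hZA m) hDm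
        (hA.prodMk (hZX m)) (hAD m)
      have h3 := finMutualInfo_le_of_condMutualInfo_eq_zero' μ (hZH m) (hDm.prodMk (hZA m))
        ((hZA m).prodMk (hZX m)) (hHDA m)
      rw [finMutualInfo_comm] at h2
      simp only [Fin.eta, Finset.Icc_self, Finset.sum_singleton, ha, hb]
      linarith
    | succ n hmn ih =>
      have hn' : n < L + 1 := by omega
      set k : Fin (L + 1) := ⟨n + 1, hn⟩ with hk
      have h1 := finMutualInfo_comp_right_le μ hDm
        ((hZH k).prodMk ((hZA k).prodMk (hZX k))) (fun v => (v.1, v.2.1))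
      have h2 := finMutualInfo_prod_eq_of_condMutualInfo_eq_zero μ (hHD k)
      have h3 := finMutualInfo_prod_le μ (D := D) (hZA k) (hZX k)
      have h4 := finMutualInfo_le_of_condMutualInfo_eq_zero' μ (hZA k) (hDm.prodMk (hZX k))
        (hA.prodMk (hZX k)) (hADX k)
      have h5 := finMutualInfo_le_of_condMutualInfo_eq_zero μ (hZX k) hDm
        ((hZH ⟨n, hn'⟩).prodMk (hZA ⟨n, hn'⟩)) (hXD ⟨n, hn'⟩ (by simpa using hn))
      have h6 := ih hn'
      have hIcc : Finset.Icc m k = insert k (Finset.Icc m ⟨n, hn'⟩) := by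
        ext l
        simp only [Finset.mem_Icc, Finset.mem_insert, Fin.le_def, Fin.ext_iff, hk]
        omega
      rw [hIcc, Finset.sum_insert (by simp [Fin.le_def, hk])]
      linarith
  have hSA' : SA = Finset.Icc m (Fin.last L) := by
    rw [hSA]; ext l; simp [Fin.le_last]
  have hbm : b m ≤ ∑ l ∈ SH, b l :=
    Finset.single_le_sum (f := b)
      (fun l _ => finMutualInfo_nonneg μ (hZH l) ((hZA l).prodMk (hZX l))) (SH.max'_mem hSH)
  have h1 := finMutualInfo_comp_right_le μ hDm
    ((hZH (Fin.last L)).prodMk (hZA (Fin.last L))) Prod.fst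
  have h2 := layer L (Nat.lt_succ_self L) (Nat.lt_succ_iff.1 m.isLt)
  rw [hSA']
  change _ ≤ b m + ∑ l ∈ Finset.Icc m (Fin.last L), a l at h2
  change finMutualInfo μ D (ZH (Fin.last L)) ≤ _ at h1
  exact h1.trans (h2.trans (by linarith))
end
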